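/- Theorem 2 (no spurious origination under the null). Under the null model H0 with Assumptions A1 and A2 and the initial-value condition, if (cv_n) is a sequence of positive thresholds with cv_n → ∞, then the probability that there exists some τ with ⌊n·r_0⌋ ≤ τ ≤ n such that SV-ADF^δ_τ > cv_n converges to 0 as n → ∞; equivalently, P(r̂_e ∈ [r_0,1]) → 0, so no origination date is (asymptotically) falsely declared. -/

import Mathlib

open MeasureTheory ProbabilityTheory Filter

/-- The average innovation variance `m_{n,k} = k⁻¹ Σ_{t=1}^k E[σ_t²]`. -/
noncomputable def avgVar {Ω : Type*} [MeasurableSpace Ω] (P : ℕ → Measure Ω)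
    (σ : ℕ → ℕ → Ω → ℝ) (n k : ℕ) : ℝ :=
  (∑ t ∈ Finset.Icc 1 k, ∫ ω, (σ n t ω) ^ 2 ∂(P n)) / k

/-- Recursive sample mean `X̄_τ = τ⁻¹ Σ_{k=1}^τ X_{k-1}`. -/
noncomputable def xbar {Ω : Type*} (X : ℕ → Ω → ℝ) (τ : ℕ) (ω : Ω) : ℝ :=
  (∑ k ∈ Finset.Icc 1 τ, X (k - 1) ω) / τ

/-- Demeaned observation `X̃_j = X_j - X̄_τ`. -/
noncomputable def xtil {Ω : Type*} (X : ℕ → Ω → ℝ) (τ j : ℕ) (ω : Ω) : ℝ :=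
  X j ω - xbar X τ ω

/-- OLS slope `δ̂(τ) = (Σ_{j=1}^τ X̃_{j-1} X_j)/(Σ_{j=1}^τ X̃_{j-1}²)`. -/
noncomputable def deltaHat {Ω : Type*} (X : ℕ → Ω → ℝ) (τ : ℕ) (ω : Ω) : ℝ :=
  (∑ j ∈ Finset.Icc 1 τ, xtil X τ (j - 1) ω * X j ω) /
    ∑ j ∈ Finset.Icc 1 τ, (xtil X τ (j - 1) ω) ^ 2

/-- Coefficient-based recursive statistic `SV-ADF^δ_τ = τ (δ̂(τ) - 1)`. -/
noncomputable def svadfDelta {Ω : Type*} (X : ℕ → Ω → ℝ) (τ : ℕ) (ω : Ω) : ℝ :=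
  (τ : ℝ) * (deltaHat X τ ω - 1)

lemma sum_Icc_shift (f : ℕ → ℝ) (τ : ℕ) :
    ∑ j ∈ Finset.Icc 1 τ, f j = ∑ j ∈ Finset.range τ, f (j + 1) := by
  induction τ with
  | zero => simp
  | succ k ih => rw [Finset.sum_Icc_succ_top (by omega), ih, Finset.sum_range_succ]

lemma num_bound (x : ℕ → ℝ) (τ : ℕ) :
    ∑ j ∈ Finset.range τ, (x j - x 0) * (x (j + 1) - x j) ≤ (x τ - x 0) ^ 2 / 2 := by
  induction τ with
  | zero => simp
  | succ k ih =>
    rw [Finset.sum_range_succ]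
    nlinarith [sq_nonneg (x (k + 1) - x k)]

lemma stat_bound {Ω : Type*} (X : ℕ → Ω → ℝ) (ω : Ω) (n τ a h : ℕ) (K d : ℝ)
    (hK : 0 ≤ K) (hd : 0 < d) (hbd : ∀ j ≤ n, |X j ω - X 0 ω| ≤ K) (hτn : τ ≤ n)
    (hah : a ≤ h) (hhτ : h + a ≤ τ)
    (hdle : d ≤ (∑ i ∈ Finset.range a, (X (h + i) ω - X i ω) ^ 2) / 2) :
    svadfDelta X τ ω ≤ n * (3 / 2 * K ^ 2) / d := by
  set x : ℕ → ℝ := fun j => X j ω with hx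
  set c := xbar X τ ω with hc
  have hτ0 : 0 < τ := by
    rcases Nat.eq_zero_or_pos a with h0 | h0
    · subst h0; simp at hdle; linarith
    · omega
  have hτ' : (0 : ℝ) < τ := by exact_mod_cast hτ0
  have hcsum : ∑ j ∈ Finset.range τ, x j = τ * c := by
    rw [hc, xbar, sum_Icc_shift (fun k => X (k - 1) ω)]
    simp only [Nat.add_sub_cancel]
    field_simp
    rfl
  set D := ∑ j ∈ Finset.range τ, (x j - c) ^ 2 with hD
  have hdD : d ≤ D := by
    refine hdle.trans ?_
    have h1 : ∑ i ∈ Finset.range a, (x i - c) ^ 2 + ∑ i ∈ Finset.range a, (x (h + i) - c) ^ 2 ≤ D := by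
      have e1 : ∑ i ∈ Finset.range a, (x i - c) ^ 2 ≤ ∑ i ∈ Finset.range h, (x i - c) ^ 2 :=
        Finset.sum_le_sum_of_subset_of_nonneg (Finset.range_mono hah) (fun _ _ _ => sq_nonneg _)
      have e2 : ∑ i ∈ Finset.range (h + a), (x i - c) ^ 2 ≤ D :=
        Finset.sum_le_sum_of_subset_of_nonneg (Finset.range_mono hhτ) (fun _ _ _ => sq_nonneg _)
      rw [Finset.sum_range_add] at e2
      linarith
    rw [← Finset.sum_add_distrib] at h1
    refine le_trans ?_ h1
    rw [Finset.sum_div]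
    refine Finset.sum_le_sum (fun i _ => ?_)
    change (x (h + i) - x i) ^ 2 / 2 ≤ _
    nlinarith [sq_nonneg (x (h + i) - c + (x i - c))]
  have hDpos : 0 < D := hd.trans_le hdD
  have hmean : ∑ j ∈ Finset.range τ, (x j - c) = 0 := by
    rw [Finset.sum_sub_distrib, hcsum]; simp
  have hδ : deltaHat X τ ω = (∑ j ∈ Finset.range τ, (x j - c) * x (j + 1)) / D := by
    rw [deltaHat, sum_Icc_shift (fun j => xtil X τ (j - 1) ω * X j ω),
      sum_Icc_shift (fun j => (xtil X τ (j - 1) ω) ^ 2)]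
    simp only [Nat.add_sub_cancel]
    rfl
  have htel : ∑ j ∈ Finset.range τ, (x (j + 1) - x j) = x τ - x 0 := Finset.sum_range_sub x τ
  have hnum : ∑ j ∈ Finset.range τ, (x j - c) * x (j + 1) =
      D + (∑ j ∈ Finset.range τ, (x j - x 0) * (x (j + 1) - x j) - (c - x 0) * (x τ - x 0)) := by
    have : ∀ j ∈ Finset.range τ, (x j - c) * x (j + 1) = (x j - c) ^ 2 + c * (x j - c) +
        (x j - x 0) * (x (j + 1) - x j) - (c - x 0) * (x (j + 1) - x j) := fun j _ => by ring
    rw [Finset.sum_congr rfl this, Finset.sum_sub_distrib, Finset.sum_add_distrib,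
      Finset.sum_add_distrib, ← Finset.mul_sum, ← Finset.mul_sum, hmean, htel]
    ring
  set N := ∑ j ∈ Finset.range τ, (x j - x 0) * (x (j + 1) - x j) - (c - x 0) * (x τ - x 0) with hN
  have hcK : |c - x 0| ≤ K := by
    have : c - x 0 = (∑ j ∈ Finset.range τ, (x j - x 0)) / τ := by
      rw [Finset.sum_sub_distrib, hcsum]; simp; field_simp
    rw [this, abs_div, abs_of_pos hτ', div_le_iff₀ hτ']
    calc _ ≤ ∑ j ∈ Finset.range τ, |x j - x 0| := Finset.abs_sum_le_sum_abs _ _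
      _ ≤ ∑ j ∈ Finset.range τ, K := Finset.sum_le_sum (fun j hj => hbd j (by
          have := Finset.mem_range.1 hj; omega))
      _ = K * τ := by simp [mul_comm]
  have hNle : N ≤ 3 / 2 * K ^ 2 := by
    have h1 := num_bound x τ
    have h2 : |x τ - x 0| ≤ K := hbd τ hτn
    have h3 : (x τ - x 0) ^ 2 ≤ K ^ 2 := sq_le_sq' (by linarith [abs_le.1 h2]) (abs_le.1 h2).2
    have h4 : |(c - x 0) * (x τ - x 0)| ≤ K * K := by
      rw [abs_mul]; exact mul_le_mul hcK h2 (abs_nonneg _) hK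
    have := (abs_le.1 h4).1
    nlinarith
  rw [svadfDelta, hδ, hnum]
  have : (D + N) / D - 1 = N / D := by field_simp; ring
  rw [this]
  calc (τ : ℝ) * (N / D) ≤ τ * (3 / 2 * K ^ 2 / d) := by
        gcongr
    _ ≤ n * (3 / 2 * K ^ 2 / d) := by gcongr
    _ = _ := by ring

/-- heat kernel, killed when the remaining variance falls below `c` -/
noncomputable def gk (c A y : ℝ) : ENNReal :=
  if c ≤ A then ENNReal.ofReal (Real.exp (-y ^ 2 / (2 * A)) / Real.sqrt A) else 0

lemma measurable_gk (c : ℝ) : Measurable (fun p : ℝ × ℝ => gk c p.1 p.2) := by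
  unfold gk
  refine Measurable.ite (measurableSet_le measurable_const measurable_fst) ?_ measurable_const
  fun_prop

lemma gk_step (c A s y : ℝ) (hc : 0 < c) :
    ∫⁻ z, gk c (A - s ^ 2) (y + s * z) ∂(gaussianReal 0 1) ≤ gk c A y := by
  unfold gk
  by_cases h : c ≤ A - s ^ 2
  · have hA : c ≤ A := by nlinarith [sq_nonneg s]
    simp only [h, hA, if_true]
    set b := A - s ^ 2 with hb
    have hbp : 0 < b := hc.trans_le h
    have hAp : 0 < A := hc.trans_le hA
    have key : ∀ z, Real.exp (-(z) ^ 2 / 2) * (Real.exp (-(y + s * z) ^ 2 / (2 * b))) =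
        Real.exp (-y ^ 2 / (2 * A)) * Real.exp (-(A / (2 * b)) * (z + y * s / A) ^ 2) := by
      intro z
      rw [← Real.exp_add, ← Real.exp_add]
      congr 1
      have : s ^ 2 = A - b := by rw [hb]; ring
      field_simp
      linear_combination (-(y^2) - A * z ^ 2) * this
    have hint : Integrable (fun z => Real.exp (-(A / (2 * b)) * (z + y * s / A) ^ 2)) :=
      (integrable_exp_neg_mul_sq (b := A / (2 * b)) (by positivity)).comp_add_right (y * s / A)
    have hint0 : ∫ z, Real.exp (-(A / (2 * b)) * (z + y * s / A) ^ 2) =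
        Real.sqrt (Real.pi / (A / (2 * b))) := by
      rw [← integral_gaussian (A / (2 * b))]
      exact integral_add_right_eq_self (fun z => Real.exp (-(A / (2 * b)) * z ^ 2)) (y * s / A)
    rw [gaussianReal_of_var_ne_zero 0 one_ne_zero,
      lintegral_withDensity_eq_lintegral_mul₀ (by fun_prop) (by fun_prop)]
    have e : ∀ z, ((gaussianPDF 0 1) * fun z =>
        ENNReal.ofReal (Real.exp (-(y + s * z) ^ 2 / (2 * b)) / Real.sqrt b)) z =
        ENNReal.ofReal (((Real.sqrt (2 * Real.pi))⁻¹ * Real.exp (-y ^ 2 / (2 * A)) / Real.sqrt b) *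
          Real.exp (-(A / (2 * b)) * (z + y * s / A) ^ 2)) := by
      intro z
      simp only [Pi.mul_apply, gaussianPDF]
      rw [← ENNReal.ofReal_mul (gaussianPDFReal_nonneg _ _ _)]
      congr 1
      have := key z
      simp only [gaussianPDFReal, NNReal.coe_one, mul_one, sub_zero]
      calc _ = (Real.sqrt (2 * Real.pi))⁻¹ / Real.sqrt b * (Real.exp (-(z) ^ 2 / 2) * (Real.exp (-(y + s * z) ^ 2 / (2 * b)))) := by ring
        _ = _ := by rw [this]; ring
    rw [lintegral_congr e, ← ofReal_integral_eq_lintegral_ofReal (hint.const_mul _)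
      (Eventually.of_forall fun z => by positivity), integral_const_mul, hint0]
    apply ENNReal.ofReal_le_ofReal
    apply le_of_eq
    have : Real.pi / (A / (2 * b)) = (2 * Real.pi) * b / A := by field_simp
    rw [this, Real.sqrt_div (by positivity), Real.sqrt_mul (by positivity : 0 ≤ 2 * Real.pi) b]
    have h1 : 0 < Real.sqrt (2 * Real.pi) := by positivity
    have h2 : 0 < Real.sqrt b := by positivity
    have h3 : 0 < Real.sqrt A := by positivity
    generalize Real.sqrt (2 * Real.pi) = q at *
    field_simp
  · simp [h]

lemma gk_one_step {Ω : Type*} (m : MeasurableSpace Ω) {m0 : MeasurableSpace Ω} (P : Measure Ω)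
    [IsProbabilityMeasure P] (hm : m ≤ m0) (e A s y : Ω → ℝ) (he : Measurable e)
    (hg : Measure.map e P = gaussianReal 0 1)
    (hind : Indep (MeasurableSpace.comap e inferInstance) m P)
    (hA : Measurable[m] A) (hs : Measurable[m] s) (hy : Measurable[m] y) (c : ℝ) (hc : 0 < c) :
    ∫⁻ ω, gk c (A ω - s ω ^ 2) (y ω + s ω * e ω) ∂P ≤ ∫⁻ ω, gk c (A ω) (y ω) ∂P := by
  let ξ : Ω → ℝ × ℝ × ℝ := fun ω => (A ω, s ω, y ω)
  have hξm : Measurable[m] ξ := hA.prodMk (hs.prodMk hy)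
  have hξ : Measurable ξ := hξm.mono hm le_rfl
  have hI : IndepFun e ξ P := by
    rw [IndepFun_iff_Indep]
    exact indep_of_indep_of_le_right hind hξm.comap_le
  have hmap := (indepFun_iff_map_prod_eq_prod_map_map hξ.aemeasurable he.aemeasurable).1 hI.symm
  let F : (ℝ × ℝ × ℝ) × ℝ → ENNReal :=
    fun p => gk c (p.1.1 - p.1.2.1 ^ 2) (p.1.2.2 + p.1.2.1 * p.2)
  have hF : Measurable F := (measurable_gk c).comp
    (f := fun p : (ℝ × ℝ × ℝ) × ℝ => (p.1.1 - p.1.2.1 ^ 2, p.1.2.2 + p.1.2.1 * p.2)) (by fun_prop)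
  have hprob : IsProbabilityMeasure (Measure.map e P) := by rw [hg]; infer_instance
  have h1 : ∫⁻ ω, gk c (A ω - s ω ^ 2) (y ω + s ω * e ω) ∂P =
      ∫⁻ p, F p ∂(Measure.map (fun ω => (ξ ω, e ω)) P) := by
    rw [lintegral_map hF (hξ.prodMk he)]
  rw [h1, hmap, lintegral_prod _ hF.aemeasurable, lintegral_map hF.lintegral_prod_right' hξ, hg]
  exact lintegral_mono fun ω => gk_step c _ _ _ hc

/-- the null model for one fixed `n` -/
structure NullModel {Ω : Type*} [MeasurableSpace Ω] (P : Measure Ω) (n : ℕ)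
    (F : ℕ → MeasurableSpace Ω) (X σ ε : ℕ → Ω → ℝ) : Prop where
  mono : Monotone F
  le : ∀ t, F t ≤ ‹MeasurableSpace Ω›
  X0 : Measurable[F 0] (X 0)
  pos : ∀ t, 1 ≤ t → t ≤ n → ∀ ω, 0 < σ t ω
  smeas : ∀ t, 1 ≤ t → t ≤ n → Measurable[F (t - 1)] (σ t)
  sint : ∀ t, 1 ≤ t → t ≤ n → Integrable (fun ω => (σ t ω) ^ 2) P
  emeas : ∀ t, Measurable (ε t)
  gauss : ∀ t, 1 ≤ t → t ≤ n → Measure.map (ε t) P = gaussianReal 0 1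
  indep : ∀ t, 1 ≤ t → t ≤ n → Indep (MeasurableSpace.comap (ε t) inferInstance) (F (t - 1)) P
  adapted : ∀ t, 1 ≤ t → t ≤ n → Measurable[F t] (fun ω => σ t ω * ε t ω)
  model : ∀ t, 1 ≤ t → t ≤ n → ∀ ω, X t ω = X (t - 1) ω + σ t ω * ε t ω

namespace NullModel

variable {Ω : Type*} [mΩ : MeasurableSpace Ω] {P : Measure Ω} {n : ℕ}
    {F : ℕ → MeasurableSpace Ω} {X σ ε : ℕ → Ω → ℝ}

lemma Xmeas (M : NullModel P n F X σ ε) : ∀ t ≤ n, Measurable[F t] (X t) := by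
  intro t
  induction t with
  | zero => intro _; exact M.X0
  | succ k ih =>
    intro hk
    have h1 : Measurable[F (k + 1)] (X k) := (ih (by omega)).mono (M.mono (by omega)) le_rfl
    have h2 := M.adapted (k + 1) (by omega) hk
    have : X (k + 1) = fun ω => X k ω + σ (k + 1) ω * ε (k + 1) ω := by
      funext ω; exact M.model (k + 1) (by omega) hk ω
    rw [this]
    exact h1.add h2

lemma smeas' (M : NullModel P n F X σ ε) {s t : ℕ} (h1 : 1 ≤ s) (hs : s ≤ n) (hst : s ≤ t + 1) :
    Measurable[F t] (σ s) :=
  (M.smeas s h1 hs).mono (M.mono (by omega)) le_rfl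

lemma Vmeas (M : NullModel P n F X σ ε) (i l t : ℕ) (hl : i + l ≤ n) (ht : i + l ≤ t + 1) :
    Measurable[F t] (fun ω => ∑ j ∈ Finset.range l, (σ (i + j + 1) ω) ^ 2) := by
  refine Finset.measurable_fun_sum _ (fun j hj => ?_)
  have := Finset.mem_range.1 hj
  exact (M.smeas' (by omega) (by omega) (by omega)).pow_const 2

lemma chain [IsProbabilityMeasure P] (M : NullModel P n F X σ ε) (c B : ℝ) (hc : 0 < c)
    (i l : ℕ) (h : i + l ≤ n) :
    ∫⁻ ω, gk c (B - ∑ j ∈ Finset.range l, (σ (i + j + 1) ω) ^ 2) (X (i + l) ω - X i ω) ∂P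
      ≤ gk c B 0 := by
  induction l with
  | zero => simp
  | succ k ih =>
    refine le_trans ?_ (ih (by omega))
    have hY : Measurable[F (i + k)] (fun ω => X (i + k) ω - X i ω) :=
      (M.Xmeas (i + k) (by omega)).sub
        ((M.Xmeas i (by omega)).mono (M.mono (by omega)) le_rfl)
    have hA : Measurable[F (i + k)]
        (fun ω => B - ∑ j ∈ Finset.range k, (σ (i + j + 1) ω) ^ 2) :=
      measurable_const.sub (M.Vmeas i k (i + k) (by omega) (by omega))
    refine le_trans (le_of_eq ?_) (gk_one_step (F (i + k)) P (M.le _) (ε (i + k + 1)) _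
      (σ (i + k + 1)) _
      (M.emeas _) (M.gauss _ (by omega) (by omega)) (M.indep (i + k + 1) (by omega) (by omega))
      hA (M.smeas (i + k + 1) (by omega) (by omega)) hY c hc)
    refine lintegral_congr fun ω => ?_
    have := M.model (i + k + 1) (by omega) (by omega) ω
    rw [Nat.add_sub_cancel] at this
    rw [Finset.sum_range_succ, ← add_assoc i k 1, this]
    congr 1 <;> ring

lemma anticonc [IsProbabilityMeasure P] (M : NullModel P n F X σ ε) (c T : ℝ) (hc : 0 < c)
    (hT : 0 < T) (i l : ℕ) (h : i + l ≤ n) :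
    P {ω | |X (i + l) ω - X i ω| ≤ Real.sqrt c ∧
        ∑ j ∈ Finset.range l, (σ (i + j + 1) ω) ^ 2 ≤ T ∧
        T - c ≤ ∑ j ∈ Finset.range l, (σ (i + j + 1) ω) ^ 2}
      ≤ ENNReal.ofReal (3 * Real.sqrt c / Real.sqrt T) := by
  set S := {ω | |X (i + l) ω - X i ω| ≤ Real.sqrt c ∧
        ∑ j ∈ Finset.range l, (σ (i + j + 1) ω) ^ 2 ≤ T ∧
        T - c ≤ ∑ j ∈ Finset.range l, (σ (i + j + 1) ω) ^ 2} with hS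
  have hsc : 0 < Real.sqrt c := Real.sqrt_pos.2 hc
  have hsT : 0 < Real.sqrt T := Real.sqrt_pos.2 hT
  have hch := M.chain c (T + c) hc i l h
  have hlow : ∀ ω ∈ S, ENNReal.ofReal (1 / (3 * Real.sqrt c)) ≤
      gk c (T + c - ∑ j ∈ Finset.range l, (σ (i + j + 1) ω) ^ 2) (X (i + l) ω - X i ω) := by
    rintro ω ⟨h1, h2, h3⟩
    set V := ∑ j ∈ Finset.range l, (σ (i + j + 1) ω) ^ 2
    set y := X (i + l) ω - X i ω
    unfold gk
    rw [if_pos (by linarith)]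
    apply ENNReal.ofReal_le_ofReal
    have hAp : 0 < T + c - V := by linarith
    have hy : y ^ 2 ≤ c := by
      rw [← sq_abs, ← Real.sq_sqrt hc.le]
      exact pow_le_pow_left₀ (abs_nonneg _) h1 2
    have hexp : (1 : ℝ) / 2 ≤ Real.exp (-y ^ 2 / (2 * (T + c - V))) := by
      have : (-1 : ℝ) / 2 ≤ -y ^ 2 / (2 * (T + c - V)) := by
        rw [div_le_div_iff₀ (by norm_num) (by linarith)]
        nlinarith
      have h4 := Real.add_one_le_exp ((-1 : ℝ) / 2)
      have h5 := Real.exp_le_exp.2 this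
      linarith
    have hsq : Real.sqrt (T + c - V) ≤ 3 / 2 * Real.sqrt c := by
      rw [Real.sqrt_le_left (by positivity), mul_pow, Real.sq_sqrt hc.le]
      linarith
    have hsp : 0 < Real.sqrt (T + c - V) := Real.sqrt_pos.2 hAp
    calc 1 / (3 * Real.sqrt c) = (1 / 2) / (3 / 2 * Real.sqrt c) := by field_simp
      _ ≤ _ := by gcongr
  have hmk : ENNReal.ofReal (1 / (3 * Real.sqrt c)) * P S ≤ gk c (T + c) 0 := by
    refine le_trans ?_ hch
    rw [← setLIntegral_const]
    have hXm : ∀ t ≤ n, Measurable (X t) := fun t ht => (M.Xmeas t ht).mono (M.le t) le_rfl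
    have hVm : Measurable (fun ω => ∑ j ∈ Finset.range l, (σ (i + j + 1) ω) ^ 2) :=
      (M.Vmeas i l n h (by omega)).mono (M.le n) le_rfl
    have hSm : MeasurableSet S := by
      have ha : Measurable (fun ω => |X (i + l) ω - X i ω|) :=
        continuous_abs.measurable.comp ((hXm _ h).sub (hXm _ (by omega)))
      have key := (measurableSet_le ha (measurable_const (a := Real.sqrt c))).inter
        ((measurableSet_le hVm (measurable_const (a := T))).inter
          (measurableSet_le (measurable_const (a := T - c)) hVm))
      convert key using 1
      ext ω
      simp [hS]
    exact (setLIntegral_mono' hSm hlow).trans (setLIntegral_le_lintegral _ _)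
  have hgk : gk c (T + c) 0 ≤ ENNReal.ofReal (1 / Real.sqrt T) := by
    unfold gk
    rw [if_pos (by linarith)]
    apply ENNReal.ofReal_le_ofReal
    have : Real.sqrt T ≤ Real.sqrt (T + c) := Real.sqrt_le_sqrt (by linarith)
    simp only [ne_eq, OfNat.ofNat_ne_zero, not_false_eq_true, zero_pow, neg_zero, zero_div,
      Real.exp_zero]
    gcongr
  have h3 := hmk.trans hgk
  rw [mul_comm, ← ENNReal.le_div_iff_mul_le (Or.inl (by simp [hc])) (Or.inl ENNReal.ofReal_ne_top),
    ← ENNReal.ofReal_div_of_pos (by positivity)] at h3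
  refine h3.trans (le_of_eq ?_)
  congr 1
  field_simp

lemma indepFun (M : NullModel P n F X σ ε) (t : ℕ) (ht : t + 1 ≤ n) (f : Ω → ℝ)
    (hf : Measurable[F t] f) : IndepFun f (ε (t + 1)) P := by
  refine IndepFun.symm ?_
  rw [IndepFun_iff_Indep]
  exact indep_of_indep_of_le_right (M.indep (t + 1) (by omega) ht) hf.comap_le

lemma e_memLp (M : NullModel P n F X σ ε) (t : ℕ) (h1 : 1 ≤ t) (ht : t ≤ n) :
    MemLp (ε t) 2 P := by
  have := memLp_id_gaussianReal' (μ := 0) (v := 1) 2 (by simp)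
  rw [← M.gauss t h1 ht] at this
  exact (memLp_map_measure_iff (by fun_prop) (M.emeas t).aemeasurable).1 this

lemma e_int (M : NullModel P n F X σ ε) (t : ℕ) (h1 : 1 ≤ t) (ht : t ≤ n) :
    ∫ ω, ε t ω ∂P = 0 := by
  have := integral_id_gaussianReal (μ := 0) (v := 1)
  rw [← M.gauss t h1 ht, integral_map (M.emeas t).aemeasurable (by fun_prop)] at this
  exact this

lemma e_int2 (M : NullModel P n F X σ ε) (t : ℕ) (h1 : 1 ≤ t) (ht : t ≤ n) :
    ∫ ω, ε t ω ^ 2 ∂P = 1 := by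
  have := variance_id_gaussianReal (μ := 0) (v := 1)
  rw [variance_of_integral_eq_zero (by fun_prop) (by simp), ← M.gauss t h1 ht,
    integral_map (M.emeas t).aemeasurable (by fun_prop)] at this
  simpa using this

lemma u_memLp (M : NullModel P n F X σ ε) (t : ℕ) (ht : t + 1 ≤ n) :
    MemLp (fun ω => σ (t + 1) ω * ε (t + 1) ω) 2 P := by
  have hm : Measurable (fun ω => σ (t + 1) ω * ε (t + 1) ω) :=
    (M.adapted (t + 1) (by omega) ht).mono (M.le _) le_rfl
  rw [memLp_two_iff_integrable_sq hm.aestronglyMeasurable]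
  have hs := M.smeas (t + 1) (by omega) ht
  have hI : IndepFun (fun ω => σ (t + 1) ω ^ 2) (fun ω => ε (t + 1) ω ^ 2) P :=
    (M.indepFun t ht _ hs).comp (φ := fun x => x ^ 2) (ψ := fun x => x ^ 2)
      (by fun_prop) (by fun_prop)
  have := hI.integrable_mul (M.sint (t + 1) (by omega) ht)
    (M.e_memLp (t + 1) (by omega) ht).integrable_sq
  refine this.congr (Eventually.of_forall fun ω => ?_)
  simp [mul_pow]

lemma u_sq (M : NullModel P n F X σ ε) (t : ℕ) (ht : t + 1 ≤ n) :
    ∫ ω, (σ (t + 1) ω * ε (t + 1) ω) ^ 2 ∂P = ∫ ω, σ (t + 1) ω ^ 2 ∂P := by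
  have hs := M.smeas (t + 1) (by omega) ht
  have hs' : Measurable (σ (t + 1)) := hs.mono (M.le _) le_rfl
  have he := M.emeas (t + 1)
  have hI : IndepFun (fun ω => σ (t + 1) ω ^ 2) (fun ω => ε (t + 1) ω ^ 2) P :=
    (M.indepFun t ht _ hs).comp (φ := fun x => x ^ 2) (ψ := fun x => x ^ 2)
      (by fun_prop) (by fun_prop)
  have := hI.integral_fun_mul_eq_mul_integral (by fun_prop) (by fun_prop)
  simp only [mul_pow]
  rw [this, M.e_int2 _ (by omega) ht, mul_one]

lemma S_memLp (M : NullModel P n F X σ ε) : ∀ t ≤ n, MemLp (fun ω => X t ω - X 0 ω) 2 P := by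
  intro t
  induction t with
  | zero => intro _; simp
  | succ k ih =>
    intro hk
    refine ((ih (by omega)).add (M.u_memLp k hk)).ae_eq (Eventually.of_forall fun ω => ?_)
    have := M.model (k + 1) (by omega) hk ω
    simp only [Nat.add_sub_cancel] at this
    simp only [Pi.add_apply, this]; ring

lemma S_meas (M : NullModel P n F X σ ε) (t : ℕ) (ht : t ≤ n) :
    Measurable[F t] (fun ω => X t ω - X 0 ω) :=
  (M.Xmeas t ht).sub (M.X0.mono (M.mono (by omega)) le_rfl)

lemma S_sq (M : NullModel P n F X σ ε) : ∀ t ≤ n, ∫ ω, (X t ω - X 0 ω) ^ 2 ∂P =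
    ∑ s ∈ Finset.Icc 1 t, ∫ ω, σ s ω ^ 2 ∂P := by
  intro t
  induction t with
  | zero => intro _; simp
  | succ k ih =>
    intro hk
    rw [Finset.sum_Icc_succ_top (by omega), ← ih (by omega), ← M.u_sq k hk]
    have h1 := M.S_memLp k (by omega)
    have h2 := M.u_memLp k hk
    have hcross : ∫ ω, (X k ω - X 0 ω) * (σ (k + 1) ω * ε (k + 1) ω) ∂P = 0 := by
      have hm : Measurable[F k] (fun ω => (X k ω - X 0 ω) * σ (k + 1) ω) :=
        (M.S_meas k (by omega)).mul (M.smeas (k + 1) (by omega) hk)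
      have hm' := hm.mono (M.le _) le_rfl
      have he := M.emeas (k + 1)
      have := (M.indepFun k hk _ hm).integral_fun_mul_eq_mul_integral
        hm'.aestronglyMeasurable (by fun_prop)
      rw [M.e_int _ (by omega) hk, mul_zero] at this
      rw [← this]
      exact integral_congr_ae (Eventually.of_forall fun ω => by simp only; ring)
    have : ∀ ω, (X (k + 1) ω - X 0 ω) ^ 2 = ((X k ω - X 0 ω) ^ 2 +
        2 * ((X k ω - X 0 ω) * (σ (k + 1) ω * ε (k + 1) ω))) + (σ (k + 1) ω * ε (k + 1) ω) ^ 2 := by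
      intro ω
      have := M.model (k + 1) (by omega) hk ω
      simp only [Nat.add_sub_cancel] at this
      rw [this]; ring
    simp only [this]
    have hi : Integrable (fun ω => (X k ω - X 0 ω) * (σ (k + 1) ω * ε (k + 1) ω)) P :=
      h1.integrable_mul h2
    have hi1 := h1.integrable_sq
    have hi2 := h2.integrable_sq
    have hi3 : Integrable (fun ω => (X k ω - X 0 ω) ^ 2 +
        2 * ((X k ω - X 0 ω) * (σ (k + 1) ω * ε (k + 1) ω))) P := hi1.add (hi.const_mul 2)
    rw [integral_add hi3 hi2, integral_add hi1 (hi.const_mul 2),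
      integral_const_mul, hcross]
    ring

lemma mart [IsProbabilityMeasure P] (M : NullModel P n F X σ ε) :
    Martingale (fun t ω => X (min t n) ω - X 0 ω) (⟨F, M.mono, M.le⟩ : Filtration ℕ mΩ) P := by
  have hadp : ∀ i, StronglyMeasurable[F i] (fun ω => X (min i n) ω - X 0 ω) := fun i =>
    ((M.S_meas (min i n) (by omega)).mono (M.mono (by omega)) le_rfl).stronglyMeasurable
  have hint : ∀ i, Integrable (fun ω => X (min i n) ω - X 0 ω) P := fun i =>
    (M.S_memLp (min i n) (by omega)).integrable (by norm_num)
  refine martingale_nat hadp hint (fun i => ?_)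
  change _ =ᵐ[P] P[fun ω => X (min (i + 1) n) ω - X 0 ω | F i]
  by_cases hi : i + 1 ≤ n
  · have e1 : min (i + 1) n = i + 1 := by omega
    have e2 : min i n = i := by omega
    have hh := hadp i
    have hii := hint i
    rw [e2] at hh hii
    rw [e1, e2]
    have e3 : (fun ω => X (i + 1) ω - X 0 ω) =
        (fun ω => X i ω - X 0 ω) + (σ (i + 1) * ε (i + 1)) := by
      funext ω
      have := M.model (i + 1) (by omega) hi ω
      simp only [Nat.add_sub_cancel] at this
      simp only [Pi.add_apply, Pi.mul_apply, this]; ring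
    have hu : Integrable (σ (i + 1) * ε (i + 1)) P := (M.u_memLp i hi).integrable (by norm_num)
    have hε : Integrable (ε (i + 1)) P := (M.e_memLp (i + 1) (by omega) hi).integrable (by norm_num)
    have h1 : P[σ (i + 1) * ε (i + 1) | F i] =ᵐ[P] σ (i + 1) * P[ε (i + 1) | F i] :=
      condExp_mul_of_stronglyMeasurable_left
        (M.smeas (i + 1) (by omega) hi).stronglyMeasurable hu hε
    have h2 : P[ε (i + 1) | F i] =ᵐ[P] fun _ => ∫ ω, ε (i + 1) ω ∂P :=
      condExp_indep_eq (M.emeas (i + 1)).comap_le (M.le i)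
        (comap_measurable _).stronglyMeasurable (M.indep (i + 1) (by omega) hi)
    rw [e3]
    have h3 := condExp_add hii hu (F i)
    rw [condExp_of_stronglyMeasurable (M.le i) hh hii] at h3
    filter_upwards [h1, h2, h3] with ω a b d
    rw [d, Pi.add_apply, a, Pi.mul_apply, b, M.e_int _ (by omega) hi]
    simp
  · have e1 : min (i + 1) n = n := by omega
    have e2 : min i n = n := by omega
    have hh := hadp i
    have hii := hint i
    rw [e2] at hh hii
    rw [e1, e2, condExp_of_stronglyMeasurable (M.le i) hh hii]

lemma half_max [IsProbabilityMeasure P] (f : ℕ → Ω → ℝ) (𝒢 : Filtration ℕ mΩ)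
    (hf : Martingale f 𝒢 P) (n : ℕ) (K q : ℝ) (hK : 0 < K) (hq : 0 < q)
    (h2 : MemLp (f n) 2 P) (hq2 : ∫ ω, f n ω ^ 2 ∂P = q ^ 2) :
    P {ω | ∃ j ≤ n, K ≤ f j ω} ≤ ENNReal.ofReal (q / K) := by
  have hsub := hf.submartingale.pos
  have hmax := maximal_ineq hsub (fun i ω => by simp [posPart_nonneg]) (ε := K.toNNReal) n
  rw [Real.coe_toNNReal K hK.le] at hmax
  have hle : ∀ (s : Set Ω), ∫ ω in s, (f⁺) n ω ∂P ≤ q := by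
    intro s
    calc _ ≤ ∫ ω in s, |f n ω| ∂P := by
          refine integral_mono ?_ ?_ (fun ω => ?_)
          · exact (hsub.integrable n).integrableOn
          · exact (hf.integrable n).abs.integrableOn
          · simp [Pi.posPart_apply, posPart_def, le_abs_self]
      _ ≤ ∫ ω, |f n ω| ∂P := setIntegral_le_integral (hf.integrable n).abs
          (Eventually.of_forall fun ω => abs_nonneg _)
      _ ≤ ∫ ω, (1 / (2 * q) * f n ω ^ 2 + q / 2) ∂P := by
          refine integral_mono (hf.integrable n).abs
            ((h2.integrable_sq.const_mul _).add (integrable_const _)) (fun ω => ?_)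
          have : 1 / (2 * q) * f n ω ^ 2 + q / 2 - |f n ω| = (|f n ω| - q) ^ 2 / (2 * q) := by
            rw [← sq_abs (f n ω)]; field_simp; ring
          have h0 : 0 ≤ (|f n ω| - q) ^ 2 / (2 * q) := by positivity
          simp only
          linarith
      _ = q := by
          rw [integral_add (h2.integrable_sq.const_mul _) (integrable_const _),
            integral_const_mul, hq2]
          simp; field_simp; norm_num
  have h3 := hmax.trans (ENNReal.ofReal_le_ofReal (hle _))
  change ENNReal.ofReal K * _ ≤ _ at h3
  rw [mul_comm, ← ENNReal.le_div_iff_mul_le (Or.inl (by simp [hK])) (Or.inl (by simp)),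
    ← ENNReal.ofReal_div_of_pos hK] at h3
  refine le_trans (measure_mono ?_) h3
  rintro ω ⟨j, hj, hjK⟩
  simp only [Set.mem_ofPred_eq]
  refine le_trans ?_ (Finset.le_sup' (fun k => (f⁺) k ω) (Finset.mem_range.2 (by omega : j < n + 1)))
  refine hjK.trans ?_
  simp [Pi.posPart_apply, le_posPart]

lemma maxbound [IsProbabilityMeasure P] (M : NullModel P n F X σ ε) (K q : ℝ) (hK : 0 < K)
    (hq : 0 < q) (hq2 : ∑ s ∈ Finset.Icc 1 n, ∫ ω, σ s ω ^ 2 ∂P = q ^ 2) :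
    P {ω | ∃ j ≤ n, K < |X j ω - X 0 ω|} ≤ ENNReal.ofReal (2 * q / K) := by
  have hS := M.S_memLp n le_rfl
  have hS2 := M.S_sq n le_rfl
  rw [hq2] at hS2
  have a1 := half_max _ _ M.mart n K q hK hq (by simpa using hS) (by simpa using hS2)
  have a2 := half_max _ _ M.mart.neg n K q hK hq (by simpa using hS.neg)
    (by simpa only [Pi.neg_apply, neg_sq, min_self] using hS2)
  have : ENNReal.ofReal (2 * q / K) = ENNReal.ofReal (q / K) + ENNReal.ofReal (q / K) := by
    rw [← ENNReal.ofReal_add (by positivity) (by positivity)]; congr 1; ring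
  rw [this]
  refine le_trans (measure_mono ?_) ((measure_union_le _ _).trans (add_le_add a1 a2))
  rintro ω ⟨j, hj, hjK⟩
  rcases lt_abs.1 hjK with h | h
  · left; exact ⟨j, hj, by simpa [hj] using h.le⟩
  · right; exact ⟨j, hj, by simp only [Pi.neg_apply, hj, min_eq_left]; exact h.le⟩

end NullModel

namespace NullModel

variable {Ω : Type*} [mΩ : MeasurableSpace Ω] {P : Measure Ω} {n : ℕ}
    {F : ℕ → MeasurableSpace Ω} {X σ ε : ℕ → Ω → ℝ}

lemma V_eq (s : ℕ → ℝ) (i l : ℕ) : ∑ j ∈ Finset.range l, (s (i + j + 1)) ^ 2 =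
    ∑ t ∈ Finset.Icc 1 (i + l), (s t) ^ 2 - ∑ t ∈ Finset.Icc 1 i, (s t) ^ 2 := by
  induction l with
  | zero => simp
  | succ k ih =>
    rw [Finset.sum_range_succ, ih, ← add_assoc, Finset.sum_Icc_succ_top (by omega)]
    ring

lemma Q_mono (s : ℕ → ℝ) {i j : ℕ} (h : i ≤ j) :
    ∑ t ∈ Finset.Icc 1 i, (s t) ^ 2 ≤ ∑ t ∈ Finset.Icc 1 j, (s t) ^ 2 :=
  Finset.sum_le_sum_of_subset_of_nonneg (Finset.Icc_subset_Icc_right h) (fun _ _ _ => sq_nonneg _)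

lemma counting [IsProbabilityMeasure P] (M : NullModel P n F X σ ε) (c T : ℝ) (hc : 0 < c)
    (hT : 0 < T) (a h b : ℕ) (ha : 0 < a) (hab : h + a ≤ b) (hb : b ≤ n) :
    P {ω | ∑ t ∈ Finset.Icc 1 b, (σ t ω) ^ 2 ≤ T ∧
        T - c ≤ ∑ t ∈ Finset.Icc 1 h, (σ t ω) ^ 2 - ∑ t ∈ Finset.Icc 1 a, (σ t ω) ^ 2 ∧
        ∑ i ∈ Finset.range a, (X (h + i) ω - X i ω) ^ 2 ≤ a * c / 2}
      ≤ ENNReal.ofReal (6 * Real.sqrt c / Real.sqrt T) := by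
  set S : ℕ → Set Ω := fun i => {ω | |X (i + h) ω - X i ω| ≤ Real.sqrt c ∧
        ∑ j ∈ Finset.range h, (σ (i + j + 1) ω) ^ 2 ≤ T ∧
        T - c ≤ ∑ j ∈ Finset.range h, (σ (i + j + 1) ω) ^ 2} with hS
  have hXm : ∀ t ≤ n, Measurable (X t) := fun t ht => (M.Xmeas t ht).mono (M.le t) le_rfl
  have hSm : ∀ i ∈ Finset.range a, MeasurableSet (S i) := by
    intro i hi
    have hi' := Finset.mem_range.1 hi
    have hVm : Measurable (fun ω => ∑ j ∈ Finset.range h, (σ (i + j + 1) ω) ^ 2) :=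
      (M.Vmeas i h n (by omega) (by omega)).mono (M.le n) le_rfl
    have ha : Measurable (fun ω => |X (i + h) ω - X i ω|) :=
      continuous_abs.measurable.comp ((hXm _ (by omega)).sub (hXm _ (by omega)))
    have key := (measurableSet_le ha (measurable_const (a := Real.sqrt c))).inter
      ((measurableSet_le hVm (measurable_const (a := T))).inter
        (measurableSet_le (measurable_const (a := T - c)) hVm))
    convert key using 1
    ext ω
    simp [hS]
  set f : Ω → ENNReal := fun ω => ∑ i ∈ Finset.range a, (S i).indicator (fun _ => 1) ω with hf
  have hfm : Measurable f :=
    Finset.measurable_fun_sum _ fun i hi => measurable_const.indicator (hSm i hi)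
  have hfint : ∫⁻ ω, f ω ∂P ≤ a * ENNReal.ofReal (3 * Real.sqrt c / Real.sqrt T) := by
    rw [hf, lintegral_finsetSum' _ fun i hi => (measurable_const.indicator (hSm i hi)).aemeasurable]
    calc _ ≤ ∑ i ∈ Finset.range a, ENNReal.ofReal (3 * Real.sqrt c / Real.sqrt T) := by
          refine Finset.sum_le_sum fun i hi => ?_
          rw [lintegral_indicator_const (hSm i hi), one_mul]
          have hi' := Finset.mem_range.1 hi
          exact M.anticonc c T hc hT i h (by omega)
      _ = _ := by simp
  have hmarkov := mul_meas_ge_le_lintegral (μ := P) hfm (ENNReal.ofReal (a / 2))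
  have ha' : (0 : ℝ) < a := by exact_mod_cast ha
  have h3 := hmarkov.trans hfint
  have e1 : (a : ENNReal) = ENNReal.ofReal a := by simp
  rw [e1, ← ENNReal.ofReal_mul ha'.le, mul_comm,
    ← ENNReal.le_div_iff_mul_le (Or.inl (by simp [ha])) (Or.inl ENNReal.ofReal_ne_top),
    ← ENNReal.ofReal_div_of_pos (by positivity)] at h3
  have e2 : (a : ℝ) * (3 * Real.sqrt c / Real.sqrt T) / (a / 2) = 6 * Real.sqrt c / Real.sqrt T := by
    field_simp; norm_num
  rw [e2] at h3
  refine le_trans (measure_mono ?_) h3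
  rintro ω ⟨h1, h2, h4⟩
  change ENNReal.ofReal (a / 2) ≤ f ω
  have hmem : ∀ i ∈ Finset.range a, |X (i + h) ω - X i ω| ≤ Real.sqrt c → ω ∈ S i := by
    intro i hi habs
    have hi' := Finset.mem_range.1 hi
    refine ⟨habs, ?_, ?_⟩
    · rw [V_eq (fun t => σ t ω)]
      have q1 := Q_mono (fun t => σ t ω) (by omega : i + h ≤ b)
      have q2 : 0 ≤ ∑ t ∈ Finset.Icc 1 i, (σ t ω) ^ 2 := Finset.sum_nonneg fun _ _ => sq_nonneg _
      linarith
    · rw [V_eq (fun t => σ t ω)]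
      have q1 := Q_mono (fun t => σ t ω) (by omega : h ≤ i + h)
      have q2 := Q_mono (fun t => σ t ω) (by omega : i ≤ a)
      linarith
  have hpt : ∀ i ∈ Finset.range a, ENNReal.ofReal (1 - (X (h + i) ω - X i ω) ^ 2 / c) ≤
      (S i).indicator (fun _ => 1) ω := by
    intro i hi
    by_cases habs : |X (i + h) ω - X i ω| ≤ Real.sqrt c
    · rw [Set.indicator_of_mem (hmem i hi habs), ENNReal.ofReal_le_one]
      have : 0 ≤ (X (h + i) ω - X i ω) ^ 2 / c := by positivity
      linarith
    · rw [ENNReal.ofReal_of_nonpos]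
      · simp
      · have : c ≤ (X (h + i) ω - X i ω) ^ 2 := by
          rw [← sq_abs, add_comm h i, ← Real.sq_sqrt hc.le]
          exact pow_le_pow_left₀ (Real.sqrt_nonneg _) (not_le.1 habs).le 2
        have := (one_le_div hc).2 this
        linarith
  refine le_trans ?_ (Finset.sum_le_sum hpt)
  have hsum : (a : ℝ) / 2 ≤ ∑ i ∈ Finset.range a, (1 - (X (h + i) ω - X i ω) ^ 2 / c) := by
    rw [Finset.sum_sub_distrib, ← Finset.sum_div]
    have : (∑ i ∈ Finset.range a, (X (h + i) ω - X i ω) ^ 2) / c ≤ a / 2 := by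
      rw [div_le_iff₀ hc]; linarith
    simp
    linarith
  refine (ENNReal.ofReal_le_ofReal hsum).trans ?_
  refine Finset.le_sum_of_subadditive ENNReal.ofReal ENNReal.ofReal_zero.le
    (fun x y => ENNReal.ofReal_add_le) _ _

lemma avg_pos [IsProbabilityMeasure P] (M : NullModel P n F X σ ε) (k : ℕ) (hk : 1 ≤ k)
    (hkn : k ≤ n) : 0 < ∑ t ∈ Finset.Icc 1 k, ∫ ω, (σ t ω) ^ 2 ∂P := by
  refine Finset.sum_pos (fun t ht => ?_) ⟨1, by simp [hk]⟩
  have ht' := Finset.mem_Icc.1 ht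
  rw [integral_pos_iff_support_of_nonneg (fun ω => sq_nonneg _) (M.sint t ht'.1 (by omega))]
  have : Function.support (fun ω => σ t ω ^ 2) = Set.univ := by
    ext ω
    simpa using (M.pos t ht'.1 (by omega) ω).ne'
  rw [this]; simp

lemma final_bound [IsProbabilityMeasure P] (M : NullModel P n F X σ ε) (w α β lam cv : ℝ)
    (a h b k : ℕ)
    (hw : 0 < w) (hsum : ∑ t ∈ Finset.Icc 1 n, ∫ ω, (σ t ω) ^ 2 ∂P = w)
    (hα : 0 < α) (hβ : 0 < β) (hl : 0 < lam) (ha : 0 < a) (hah : a ≤ h) (hab : h + a ≤ b)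
    (hbk : b ≤ k) (hkn : k ≤ n) (han : n * α / 2 ≤ a) (hcv : 12 * lam ^ 2 / (5 * α ^ 2) ≤ cv) :
    P {ω | ∃ τ : ℕ, k ≤ τ ∧ τ ≤ n ∧ cv < svadfDelta X τ ω} ≤
      ENNReal.ofReal (2 / lam) + ENNReal.ofReal (6 * Real.sqrt (5 * α / β)) +
      (P {ω | α * w < |∑ t ∈ Finset.Icc 1 a, (σ t ω) ^ 2 - α * w|} +
       P {ω | α * w < |∑ t ∈ Finset.Icc 1 h, (σ t ω) ^ 2 - β * w|} +
       P {ω | α * w < |∑ t ∈ Finset.Icc 1 b, (σ t ω) ^ 2 - (α + β) * w|}) := by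
  have hq : 0 < Real.sqrt w := Real.sqrt_pos.2 hw
  have b1 := M.maxbound (lam * Real.sqrt w) (Real.sqrt w) (by positivity) hq
    (by rw [hsum, Real.sq_sqrt hw.le])
  have e1 : 2 * Real.sqrt w / (lam * Real.sqrt w) = 2 / lam := by field_simp
  rw [e1] at b1
  have b2 := M.counting (5 * α * w) ((β + 2 * α) * w) (by positivity) (by positivity) a h b ha hab
    (by omega)
  have e2 : 6 * Real.sqrt (5 * α * w) / Real.sqrt ((β + 2 * α) * w) ≤
      6 * Real.sqrt (5 * α / β) := by
    rw [mul_div_assoc, ← Real.sqrt_div (by positivity)]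
    have : 5 * α * w / ((β + 2 * α) * w) ≤ 5 * α / β := by
      rw [mul_div_mul_right _ _ hw.ne']
      gcongr
      linarith
    gcongr
  have b2' := b2.trans (ENNReal.ofReal_le_ofReal e2)
  set G1 := {ω | α * w < |∑ t ∈ Finset.Icc 1 a, (σ t ω) ^ 2 - α * w|} with hG1
  set G2 := {ω | α * w < |∑ t ∈ Finset.Icc 1 h, (σ t ω) ^ 2 - β * w|} with hG2
  set G3 := {ω | α * w < |∑ t ∈ Finset.Icc 1 b, (σ t ω) ^ 2 - (α + β) * w|} with hG3
  have b3 : P ((G1 ∪ G2) ∪ G3) ≤ P G1 + P G2 + P G3 :=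
    (measure_union_le _ _).trans (add_le_add_left (measure_union_le _ _) _)
  refine le_trans (measure_mono ?_) ((measure_union_le _ _).trans
    (add_le_add ((measure_union_le _ _).trans (add_le_add b1 b2')) b3))
  rintro ω ⟨τ, hτ1, hτ2, hτ3⟩
  by_contra hcon
  simp only [Set.mem_union, not_or] at hcon
  obtain ⟨⟨c1, c2⟩, ⟨c3, c4⟩, c5⟩ := hcon
  simp only [hG1, hG2, hG3, Set.mem_ofPred_eq, not_lt, not_exists, not_and] at c1 c2 c3 c4 c5
  rw [abs_le] at c3 c4 c5
  have c2' := c2 (by linarith) (by linarith)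
  rw [not_le] at c2'
  have hn : (0 : ℝ) < n := by
    have : 0 < n := by omega
    exact_mod_cast this
  have ha' : (0 : ℝ) < a := by exact_mod_cast ha
  have hst := stat_bound X ω n τ a h (lam * Real.sqrt w) (a * (5 * α * w) / 4) (by positivity)
    (by positivity) c1 hτ2 hah (by omega) (by linarith)
  have : n * (3 / 2 * (lam * Real.sqrt w) ^ 2) / (a * (5 * α * w) / 4) ≤
      12 * lam ^ 2 / (5 * α ^ 2) := by
    rw [mul_pow, Real.sq_sqrt hw.le]
    rw [div_le_div_iff₀ (by positivity) (by positivity)]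
    have hh := mul_le_mul_of_nonneg_left han (by positivity : 0 ≤ lam ^ 2 * α * w * 15)
    nlinarith
  linarith

end NullModel

/-- Theorem 2 (no spurious origination under the null): in the unit-root null model,
under Assumptions A1, A2 and the initial-value condition, if the positive thresholds
`cv_n → ∞`, then `P(∃ τ, ⌊n r₀⌋ ≤ τ ≤ n, SV-ADF^δ_τ > cv_n) → 0`; i.e. no origination
date is asymptotically falsely declared on `[r₀, 1]`. -/
theorem no_spurious_origination {Ω : Type*} [MeasurableSpace Ω]
    (P : ℕ → Measure Ω) (hP : ∀ n, IsProbabilityMeasure (P n))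
    (ℱ : ℕ → ℕ → MeasurableSpace Ω) (hℱmono : ∀ n, Monotone (ℱ n))
    (hℱle : ∀ n t, ℱ n t ≤ ‹MeasurableSpace Ω›)
    (X σ ε : ℕ → ℕ → Ω → ℝ)
    (hX0meas : ∀ n, Measurable[ℱ n 0] (X n 0))
    (hσpos : ∀ n t, 1 ≤ t → t ≤ n → ∀ ω, 0 < σ n t ω)
    (hσmeas : ∀ n t, 1 ≤ t → t ≤ n → Measurable[ℱ n (t - 1)] (σ n t))
    (hσint : ∀ n t, 1 ≤ t → t ≤ n → Integrable (fun ω => (σ n t ω) ^ 2) (P n))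
    (hεmeas : ∀ n t, Measurable (ε n t))
    (hεgauss : ∀ n t, 1 ≤ t → t ≤ n → Measure.map (ε n t) (P n) = gaussianReal 0 1)
    (hεindep : ∀ n t, 1 ≤ t → t ≤ n →
      Indep (MeasurableSpace.comap (ε n t) inferInstance) (ℱ n (t - 1)) (P n))
    (huadapted : ∀ n t, 1 ≤ t → t ≤ n →
      Measurable[ℱ n t] (fun ω => σ n t ω * ε n t ω))
    -- null model H0 (unit root)
    (hmodel : ∀ n t, 1 ≤ t → t ≤ n → ∀ ω,
      X n t ω = X n (t - 1) ω + σ n t ω * ε n t ω)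
    (r0 : ℝ) (hr0 : r0 ∈ Set.Ioo (0 : ℝ) 1)
    -- Assumption A1
    (hA1 : ∀ r ∈ Set.Ioc (0 : ℝ) 1, ∀ εp : ℝ, 0 < εp →
      Tendsto (fun n : ℕ => P n {ω |
          εp ≤ |(∑ t ∈ Finset.Icc 1 ⌊(n : ℝ) * r⌋₊, (σ n t ω) ^ 2) /
            ((⌊(n : ℝ) * r⌋₊ : ℝ) * avgVar P σ n ⌊(n : ℝ) * r⌋₊) - 1|})
        atTop (nhds 0))
    -- Assumption A2
    (hA2 : ∃ ζ ∈ Set.Ioo (0 : ℝ) 1, ∃ g : ℕ → ℝ,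
      g =o[atTop] (fun n : ℕ => (n : ℝ) ^ (-(1 : ℝ) / 2)) ∧
      ∀ n t : ℕ, (n : ℝ) ^ ζ < (t : ℝ) → t ≤ n →
        |avgVar P σ n t / avgVar P σ n n - 1| ≤ g n)
    -- initial-value condition
    (hinit : ∀ εp : ℝ, 0 < εp →
      Tendsto (fun n : ℕ => P n {ω |
          εp ≤ |X n 0 ω / Real.sqrt ((n : ℝ) * avgVar P σ n n)|})
        atTop (nhds 0))
    -- diverging thresholds
    (cv : ℕ → ℝ) (hcvpos : ∀ n, 0 < cv n) (hcv : Tendsto cv atTop atTop) :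
    Tendsto (fun n : ℕ => P n {ω |
        ∃ τ : ℕ, ⌊(n : ℝ) * r0⌋₊ ≤ τ ∧ τ ≤ n ∧ cv n < svadfDelta (X n) τ ω})
      atTop (nhds 0) := by
  have M : ∀ n, NullModel (P n) n (ℱ n) (X n) (σ n) (ε n) := fun n =>
    ⟨hℱmono n, hℱle n, hX0meas n, hσpos n, hσmeas n, hσint n, hεmeas n, hεgauss n, hεindep n,
      huadapted n, hmodel n⟩
  set w : ℕ → ℝ := fun n => ∑ t ∈ Finset.Icc 1 n, ∫ ω, (σ n t ω) ^ 2 ∂(P n) with hw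
  -- convergence of the normalised realised variance
  have hconv : ∀ r ∈ Set.Ioc (0 : ℝ) 1, ∀ e : ℝ, 0 < e →
      Tendsto (fun n : ℕ => P n {ω | e * w n <
        |∑ t ∈ Finset.Icc 1 ⌊(n : ℝ) * r⌋₊, (σ n t ω) ^ 2 - r * w n|}) atTop (nhds 0) := by
    intro r hr e he
    obtain ⟨ζ, hζ, g, hg, hA⟩ := hA2
    have hkn : Tendsto (fun n : ℕ => (⌊(n : ℝ) * r⌋₊ : ℝ) / n) atTop (nhds r) := by
      have := (tendsto_nat_floor_mul_div_atTop hr.1.le).comp (tendsto_natCast_atTop_atTop (R := ℝ))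
      refine this.congr fun n => ?_
      simp [mul_comm]
    have hg0 : Tendsto g atTop (nhds 0) := by
      refine hg.isBigO.trans_tendsto ?_
      have := (tendsto_rpow_neg_atTop (by norm_num : (0 : ℝ) < 1 / 2)).comp
        (tendsto_natCast_atTop_atTop (R := ℝ))
      refine this.congr fun n => ?_
      simp [neg_div]
    have hpow : ∀ᶠ n : ℕ in atTop, (n : ℝ) ^ ζ < (⌊(n : ℝ) * r⌋₊ : ℝ) := by
      have h1 : Tendsto (fun n : ℕ => (n : ℝ) ^ (-(1 - ζ))) atTop (nhds 0) :=
        (tendsto_rpow_neg_atTop (by linarith [hζ.2])).comp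
          (tendsto_natCast_atTop_atTop (R := ℝ))
      filter_upwards [h1.eventually_lt hkn hr.1, eventually_gt_atTop 0] with n hn hn0
      have hn0' : (0 : ℝ) < n := by exact_mod_cast hn0
      rw [lt_div_iff₀ hn0'] at hn
      calc (n : ℝ) ^ ζ = (n : ℝ) ^ (-(1 - ζ)) * n := by
            rw [← Real.rpow_add_one hn0'.ne']; congr 1; ring
        _ < _ := hn
    have hratio : Tendsto (fun n : ℕ => avgVar P σ n ⌊(n : ℝ) * r⌋₊ / avgVar P σ n n)
        atTop (nhds 1) := by
      rw [← tendsto_sub_nhds_zero_iff]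
      refine squeeze_zero_norm' ?_ hg0
      filter_upwards [hpow] with n hn
      rw [Real.norm_eq_abs]
      refine hA n _ hn ?_
      exact Nat.floor_le_of_le (mul_le_of_le_one_right (by positivity) hr.2)
    have hρ := hkn.mul hratio
    rw [mul_one] at hρ
    have hA1' := hA1 r hr (e / 4) (by positivity)
    refine tendsto_of_tendsto_of_tendsto_of_le_of_le' tendsto_const_nhds hA1'
      (Eventually.of_forall fun n => bot_le) ?_
    have hρ1 : ∀ᶠ n : ℕ in atTop, |(⌊(n : ℝ) * r⌋₊ : ℝ) / n *
        (avgVar P σ n ⌊(n : ℝ) * r⌋₊ / avgVar P σ n n) - r| < min (e / 2) 1 := by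
      have := (Metric.tendsto_nhds.1 hρ) (min (e / 2) 1) (by positivity)
      simpa [Real.dist_eq] using this
    filter_upwards [hρ1, hpow, eventually_gt_atTop 0] with n h1 h2 hn0
    refine measure_mono fun ω hω => ?_
    simp only [Set.mem_ofPred_eq] at hω ⊢
    set k := ⌊(n : ℝ) * r⌋₊ with hk
    have hkn' : k ≤ n := Nat.floor_le_of_le (mul_le_of_le_one_right (by positivity) hr.2)
    have hn0' : (0 : ℝ) < n := by exact_mod_cast hn0
    have hk0' : (0 : ℝ) < k := lt_of_le_of_lt (by positivity) h2
    have hk0 : 1 ≤ k := by exact_mod_cast hk0'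
    have hwk := (M n).avg_pos k hk0 hkn'
    have hwn : 0 < w n := (M n).avg_pos n hn0 le_rfl
    have ek : (k : ℝ) * avgVar P σ n k = ∑ t ∈ Finset.Icc 1 k, ∫ ω, (σ n t ω) ^ 2 ∂(P n) := by
      rw [avgVar]; field_simp
    have en : (n : ℝ) * avgVar P σ n n = w n := by
      rw [avgVar]; field_simp; rfl
    have eρ : (k : ℝ) / n * (avgVar P σ n k / avgVar P σ n n) =
        (∑ t ∈ Finset.Icc 1 k, ∫ ω, (σ n t ω) ^ 2 ∂(P n)) / w n := by
      rw [div_mul_div_comm, ek, en]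
    rw [eρ] at h1
    rw [ek]
    set W := ∑ t ∈ Finset.Icc 1 k, ∫ ω, (σ n t ω) ^ 2 ∂(P n)
    set Q := ∑ t ∈ Finset.Icc 1 k, (σ n t ω) ^ 2
    have hm1 := h1.trans_le (min_le_left _ _)
    have hm2 := h1.trans_le (min_le_right _ _)
    by_contra hlt
    rw [not_le] at hlt
    have hρ2 : W / w n ≤ 2 := by linarith [(abs_lt.1 hm2).2, hr.2]
    have hρ0 : 0 < W / w n := by positivity
    have key : Q - r * w n = ((Q / W - 1) * (W / w n) + (W / w n - r)) * w n := by
      field_simp; ring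
    rw [key, abs_mul, abs_of_pos hwn] at hω
    have hω' := lt_of_mul_lt_mul_right hω hwn.le
    have t1 := abs_add_le ((Q / W - 1) * (W / w n)) (W / w n - r)
    rw [abs_mul, abs_of_pos hρ0] at t1
    have t2 : |Q / W - 1| * (W / w n) ≤ e / 4 * 2 := by
      exact mul_le_mul hlt.le hρ2 hρ0.le (by positivity)
    linarith
  rw [ENNReal.tendsto_nhds_zero]
  intro δ hδ
  by_cases hδtop : δ = ⊤
  · simp [hδtop]
  set e := δ.toReal with he
  have he0 : 0 < e := ENNReal.toReal_pos hδ.ne' hδtop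
  have hδe : δ = ENNReal.ofReal e := (ENNReal.ofReal_toReal hδtop).symm
  obtain ⟨hr00, hr01⟩ := hr0
  set β := r0 / 2 with hβ
  have hβ0 : 0 < β := by positivity
  set α := min β (β * (e / 24) ^ 2 / 5) with hα
  have hα0 : 0 < α := by positivity
  have hαβ : α ≤ β := min_le_left _ _
  have hαe : 6 * Real.sqrt (5 * α / β) ≤ e / 4 := by
    have h1 : α ≤ β * (e / 24) ^ 2 / 5 := min_le_right _ _
    have : Real.sqrt (5 * α / β) ≤ e / 24 := by
      rw [Real.sqrt_le_left (by positivity), div_le_iff₀ hβ0]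
      linarith
    linarith
  have hsix : (0 : ENNReal) < ENNReal.ofReal (e / 6) := by simp [he0]
  have g1 := ENNReal.tendsto_nhds_zero.1 (hconv α ⟨hα0, by linarith⟩ α hα0) _ hsix
  have g2 := ENNReal.tendsto_nhds_zero.1 (hconv β ⟨hβ0, by linarith⟩ α hα0) _ hsix
  have g3 := ENNReal.tendsto_nhds_zero.1 (hconv (α + β) ⟨by positivity, by linarith⟩ α hα0) _ hsix
  have hbig : ∀ᶠ n : ℕ in atTop, 2 / α ≤ (n : ℝ) :=
    (tendsto_natCast_atTop_atTop (R := ℝ)).eventually_ge_atTop _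
  filter_upwards [g1, g2, g3, hbig, hcv.eventually_ge_atTop (12 * (8 / e) ^ 2 / (5 * α ^ 2)),
    eventually_gt_atTop 0] with n q1 q2 q3 hn hcvn hn0
  have hn0' : (0 : ℝ) < n := by exact_mod_cast hn0
  rw [div_le_iff₀ hα0] at hn
  have hfl : (n : ℝ) * α - 1 < (⌊(n : ℝ) * α⌋₊ : ℝ) := by
    linarith [Nat.lt_floor_add_one ((n : ℝ) * α)]
  have hfb := (M n).final_bound (w n) α β (8 / e) (cv n) ⌊(n : ℝ) * α⌋₊ ⌊(n : ℝ) * β⌋₊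
    ⌊(n : ℝ) * (α + β)⌋₊ ⌊(n : ℝ) * r0⌋₊ ((M n).avg_pos n hn0 le_rfl) rfl hα0 hβ0 (by positivity)
    (Nat.floor_pos.2 (by linarith)) (Nat.floor_le_floor (by gcongr))
    (by
      rw [Nat.le_floor_iff (by positivity)]
      push_cast
      have z1 := Nat.floor_le (by positivity : 0 ≤ (n : ℝ) * α)
      have z2 := Nat.floor_le (by positivity : 0 ≤ (n : ℝ) * β)
      linarith)
    (Nat.floor_le_floor (mul_le_mul_of_nonneg_left (by linarith) hn0'.le))
    (Nat.floor_le_of_le (mul_le_of_le_one_right (by positivity) hr01.le))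
    (by linarith) hcvn
  refine hfb.trans ?_
  have e0 : (2 : ℝ) / (8 / e) = e / 4 := by field_simp; norm_num
  calc _ ≤ ENNReal.ofReal (e / 4) + ENNReal.ofReal (e / 4) +
        (ENNReal.ofReal (e / 6) + ENNReal.ofReal (e / 6) + ENNReal.ofReal (e / 6)) := by
        rw [e0]
        gcongr
    _ = δ := by
        rw [hδe, ← ENNReal.ofReal_add (by positivity) (by positivity),
          ← ENNReal.ofReal_add (by positivity) (by positivity),
          ← ENNReal.ofReal_add (by positivity) (by positivity),
          ← ENNReal.ofReal_add (by positivity) (by positivity)]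
        congr 1
        ring
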